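/- Let A and B be compact sets in ℝ² with 0 ∈ A, 0 ∈ B, and such that the affine spans of A and of B are both all of ℝ² (i.e., dim(A) = dim(B) = 2). Suppose x ∈ conv(A+B) but x ∉ A + conv(B) and x ∉ conv(A) + B. Then there exist a₁, a₂ ∈ A and b₁, b₂ ∈ B such that |a₁ − a₂| ≤ 2·d(A), |b₁ − b₂| ≤ 2·d(B), and x ∈ [a₁, a₂] + [b₁, b₂], where [p, q] denotes the closed segment from p to q; that is, x belongs to a parallelogram with vertex set contained in A+B and side lengths at most 2·d(A) and 2·d(B). -/

import Mathlib

open Pointwise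

/-- Hausdorff distance from a set to its convex hull. -/
noncomputable def hdist {n : ℕ} (A : Set (EuclideanSpace ℝ (Fin n))) : ℝ :=
  Metric.hausdorffDist (convexHull ℝ A) A

section Helpers

open Module

/-- Carathéodory's exchange step: when the points outnumber the dimension and lie on a hyperplane
`f = 1`, the weights of a nonnegative combination can be changed so that some weight other than
that of `k` vanishes. -/
lemma exists_nonneg_weights_eq_zero {V ι : Type*} [AddCommGroup V] [Module ℝ V]
    [FiniteDimensional ℝ V] [Fintype ι] (hcard : finrank ℝ V < Fintype.card ι)
    (z : ι → V) (f : V →ₗ[ℝ] ℝ) (hf : ∀ i, f (z i) = 1) (c : ι → ℝ) (hc : ∀ i, 0 ≤ c i) (k : ι) :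
    ∃ c' : ι → ℝ, (∀ i, 0 ≤ c' i) ∧ ∑ i, c' i • z i = ∑ i, c i • z i ∧ ∃ i ≠ k, c' i = 0 := by
  have hrel : ∃ d : ι → ℝ, ∑ i, d i • z i = 0 ∧ d ≠ 0 ∧ 0 ≤ d k := by
    have hker : LinearMap.ker (Fintype.linearCombination ℝ z) ≠ ⊥ :=
      LinearMap.ker_ne_bot_of_finrank_lt (by simpa using hcard)
    obtain ⟨d, hd, hd0⟩ := Submodule.exists_mem_ne_zero_of_ne_bot hker
    rw [LinearMap.mem_ker, Fintype.linearCombination_apply] at hd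
    rcases le_total 0 (d k) with h | h
    · exact ⟨d, hd, hd0, h⟩
    · exact ⟨-d, by simp [hd], neg_ne_zero.2 hd0, by simpa using h⟩
  obtain ⟨d, hd, hd0, hdk⟩ := hrel
  have hsum : ∑ i, d i = 0 := by
    simpa [map_sum, hf] using congrArg f hd
  have hneg : ∃ i, d i < 0 := by
    by_contra! h
    exact hd0 (funext fun i => (Finset.sum_eq_zero_iff_of_nonneg fun i _ => h i).1 hsum i
      (Finset.mem_univ i))
  classical
  obtain ⟨j, hj, hmin⟩ := Finset.exists_min_image (Finset.univ.filter fun i => d i < 0)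
    (fun i => c i / -d i) (by simpa [Finset.Nonempty] using hneg)
  have hdj : d j < 0 := by simpa using hj
  have ht : 0 ≤ c j / -d j := div_nonneg (hc j) (by linarith)
  refine ⟨fun i => c i + c j / -d j * d i, fun i => ?_, ?_, j, ?_, ?_⟩
  · rcases le_or_gt 0 (d i) with h | h
    · have := hc i
      positivity
    · have := hmin i (by simpa using h)
      rw [le_div_iff₀ (by linarith)] at this
      linarith
  · simp_rw [add_smul, mul_smul, Finset.sum_add_distrib, ← Finset.smul_sum, hd, smul_zero,
      add_zero]
  · rintro rfl
    linarith
  · have := hdj.ne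
    field_simp
    ring

/-- In the plane, a point of a parallelogram `[a₁, a₂] + [b₁, b₂]` stays in one of the
parallelograms obtained by replacing an endpoint of `[a₁, a₂]` by `c`, unless it lies in the
translate of the triangle `a₁ a₂ c` by `b₁` or `b₂`. -/
lemma segment_add_segment_replace {E : Type*} [AddCommGroup E] [Module ℝ E]
    [FiniteDimensional ℝ E] (hE : finrank ℝ E ≤ 2) {a₁ a₂ b₁ b₂ x : E} (c : E)
    (hx : x ∈ segment ℝ a₁ a₂ + segment ℝ b₁ b₂) :
    x ∈ segment ℝ a₁ c + segment ℝ b₁ b₂ ∨ x ∈ segment ℝ c a₂ + segment ℝ b₁ b₂ ∨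
      x ∈ convexHull ℝ {a₁, a₂, c} + {b₁, b₂} := by
  obtain ⟨_, ⟨l₁, l₂, hl₁, hl₂, hl, rfl⟩, _, ⟨m₁, m₂, hm₁, hm₂, hm, rfl⟩, rfl⟩ := hx
  obtain ⟨w, hw, hsum, i, hi, hwi⟩ := exists_nonneg_weights_eq_zero (V := E × ℝ × ℝ)
    (by simp only [finrank_prod, finrank_self, Fintype.card_fin]; lia)
    ![(a₁, 1, 0), (a₂, 1, 0), (c, 1, 0), (b₁, 0, 1), (b₂, 0, 1)]
    ((LinearMap.fst ℝ ℝ ℝ + LinearMap.snd ℝ ℝ ℝ) ∘ₗ LinearMap.snd ℝ E (ℝ × ℝ))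
    (by intro i; fin_cases i <;> simp)
    ![l₁, l₂, 0, m₁, m₂] (by intro i; fin_cases i <;> simp [*]) 2
  simp only [Fin.sum_univ_five, Matrix.cons_val, Prod.smul_mk, Prod.mk_add_mk, Prod.mk.injEq,
    smul_eq_mul, mul_one, mul_zero, add_zero, zero_add, zero_smul, hl, hm] at hsum
  obtain ⟨hx, hA, hB⟩ := hsum
  have hx' : l₁ • a₁ + l₂ • a₂ + (m₁ • b₁ + m₂ • b₂) =
      (w 0 • a₁ + w 1 • a₂ + w 2 • c) + (w 3 • b₁ + w 4 • b₂) := by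
    rw [← add_assoc, ← hx]; abel
  have hb : w 3 • b₁ + w 4 • b₂ ∈ segment ℝ b₁ b₂ := ⟨_, _, hw 3, hw 4, hB, rfl⟩
  have ht : w 0 • a₁ + w 1 • a₂ + w 2 • c ∈ convexHull ℝ {a₁, a₂, c} := by
    have := (convex_convexHull ℝ {a₁, a₂, c}).sum_mem (t := Finset.univ)
      (w := ![w 0, w 1, w 2]) (z := ![a₁, a₂, c])
      (by intro i _; fin_cases i <;> simp [hw]) (by simpa [Fin.sum_univ_three] using hA)
      (by intro i _; apply subset_convexHull; fin_cases i <;> simp)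
    simpa [Fin.sum_univ_three] using this
  beta_reduce
  rw [hx']
  fin_cases i
  · exact .inr <| .inl <| Set.add_mem_add
      ⟨w 2, w 1, hw 2, hw 1, by simp_all; linarith, by simp_all [add_comm]⟩ hb
  · exact .inl <| Set.add_mem_add
      ⟨w 0, w 2, hw 0, hw 2, by simp_all, by simp_all⟩ hb
  · simp at hi
  · exact .inr <| .inr <| Set.add_mem_add ht (by simp_all)
  · exact .inr <| .inr <| Set.add_mem_add ht (by simp_all)

/-- The Shapley–Folkman theorem for two sets in the plane. -/
lemma exists_mem_segment_add_segment {E : Type*} [AddCommGroup E] [Module ℝ E]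
    [FiniteDimensional ℝ E] (hE : finrank ℝ E ≤ 2) {A B : Set E} {x : E}
    (hx : x ∈ convexHull ℝ (A + B))
    (hx₁ : x ∉ A + convexHull ℝ B) (hx₂ : x ∉ convexHull ℝ A + B) :
    ∃ a₁ ∈ A, ∃ a₂ ∈ A, ∃ b₁ ∈ B, ∃ b₂ ∈ B, x ∈ segment ℝ a₁ a₂ + segment ℝ b₁ b₂ := by
  classical
  -- Lift `A` and `B` to heights `1` and `-1`.
  have hlift : ((1 / 2 : ℝ) • x, (0 : ℝ)) ∈ convexHull ℝ (A ×ˢ {(1 : ℝ)} ∪ B ×ˢ {(-1 : ℝ)}) := by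
    rw [convexHull_add] at hx
    obtain ⟨a, ha, b, hb, rfl⟩ := hx
    have ha' : (a, (1 : ℝ)) ∈ convexHull ℝ (A ×ˢ {(1 : ℝ)} ∪ B ×ˢ {(-1 : ℝ)}) :=
      convexHull_mono Set.subset_union_left (by simpa [convexHull_prod] using ha)
    have hb' : (b, (-1 : ℝ)) ∈ convexHull ℝ (A ×ˢ {(1 : ℝ)} ∪ B ×ˢ {(-1 : ℝ)}) :=
      convexHull_mono Set.subset_union_right (by simpa [convexHull_prod] using hb)
    have := convex_convexHull ℝ _ ha' hb' (a := 1 / 2) (b := 1 / 2)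
      (by norm_num) (by norm_num) (by norm_num)
    simpa using this
  obtain ⟨ι, _, z, w, hz, hind, hw, hw1, hwz⟩ := eq_pos_convex_span_of_mem_convexHull hlift
  have hcard : Fintype.card ι ≤ 4 := by
    have h₁ := hind.card_le_finrank_succ
    have h₂ := Submodule.finrank_le (vectorSpan ℝ (Set.range z))
    rw [finrank_prod, finrank_self] at h₂
    lia
  have hz' : ∀ i, (z i).1 ∈ A ∧ (z i).2 = 1 ∨ (z i).1 ∈ B ∧ (z i).2 = -1 := fun i => by
    simpa using hz ⟨i, rfl⟩
  set I := Finset.univ.filter fun i => (z i).2 = 1 with hI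
  have hA : ∀ i ∈ I, (z i).1 ∈ A := by grind
  have hB : ∀ i ∈ Iᶜ, (z i).1 ∈ B := by grind [Finset.mem_compl]
  have hfst : ∑ i, w i • (z i).1 = (1 / 2 : ℝ) • x := by
    simpa [Prod.fst_sum] using congrArg Prod.fst hwz
  have hsnd : ∑ i, w i * (z i).2 = 0 := by
    simpa [Prod.snd_sum] using congrArg Prod.snd hwz
  rw [← Finset.sum_add_sum_compl I] at hfst hsnd hw1
  have hIw : ∑ i ∈ I, w i * (z i).2 = ∑ i ∈ I, w i := Finset.sum_congr rfl (by grind)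
  have hJw : ∑ i ∈ Iᶜ, w i * (z i).2 = -∑ i ∈ Iᶜ, w i := by
    rw [← Finset.sum_neg_distrib]
    exact Finset.sum_congr rfl (by grind [Finset.mem_compl])
  have hwI : ∑ i ∈ I, 2 * w i = 1 := by rw [← Finset.mul_sum]; linarith
  have hwJ : ∑ i ∈ Iᶜ, 2 * w i = 1 := by rw [← Finset.mul_sum]; linarith
  have hxsum : x = ∑ i ∈ I, (2 * w i) • (z i).1 + ∑ i ∈ Iᶜ, (2 * w i) • (z i).1 := by
    simp_rw [mul_smul, ← Finset.smul_sum, ← smul_add, hfst, smul_smul]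
    norm_num
  have hw2 : ∀ i, 0 ≤ 2 * w i := fun i => by linarith [hw i]
  have hhull : ∀ {S : Finset ι} {C : Set E}, (∀ i ∈ S, (z i).1 ∈ C) → ∑ i ∈ S, 2 * w i = 1 →
      ∑ i ∈ S, (2 * w i) • (z i).1 ∈ convexHull ℝ C := fun hC h1 =>
    (convex_convexHull ℝ _).sum_mem (fun i _ => hw2 i) h1
      fun i hi => subset_convexHull ℝ _ (hC i hi)
  have htwo : ∀ {S : Finset ι} {C : Set E}, (∀ i ∈ S, (z i).1 ∈ C) → ∑ i ∈ S, 2 * w i = 1 →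
      ∑ i ∈ S, (2 * w i) • (z i).1 ∉ C → 2 ≤ S.card := by
    intro S C hC h1 hnot
    by_contra! hlt
    interval_cases hS : S.card
    · simp [Finset.card_eq_zero.1 hS] at h1
    · obtain ⟨i, rfl⟩ := Finset.card_eq_one.1 hS
      rw [Finset.sum_singleton] at h1 hnot
      rw [h1, one_smul] at hnot
      exact hnot (hC i (Finset.mem_singleton_self i))
  have hseg : ∀ {S : Finset ι} {C : Set E}, (∀ i ∈ S, (z i).1 ∈ C) → ∑ i ∈ S, 2 * w i = 1 →
      S.card = 2 → ∃ c₁ ∈ C, ∃ c₂ ∈ C, ∑ i ∈ S, (2 * w i) • (z i).1 ∈ segment ℝ c₁ c₂ := by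
    intro S C hC h1 hS
    obtain ⟨i, j, hij, rfl⟩ := Finset.card_eq_two.1 hS
    rw [Finset.sum_pair hij] at h1 ⊢
    exact ⟨_, hC i (by simp), _, hC j (by simp), _, _, hw2 i, hw2 j, h1, rfl⟩
  have hI2 := htwo hA hwI fun h => hx₁ (hxsum ▸ Set.add_mem_add h (hhull hB hwJ))
  have hJ2 := htwo hB hwJ fun h => hx₂ (hxsum ▸ Set.add_mem_add (hhull hA hwI) h)
  have hIJ := Finset.card_add_card_compl I
  obtain ⟨a₁, ha₁, a₂, ha₂, ha⟩ := hseg hA hwI (by lia)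
  obtain ⟨b₁, hb₁, b₂, hb₂, hb⟩ := hseg hB hwJ (by lia)
  exact ⟨a₁, ha₁, a₂, ha₂, b₁, hb₁, b₂, hb₂, hxsum ▸ Set.add_mem_add ha hb⟩

lemma exists_dist_le_hdist {n : ℕ} {A : Set (EuclideanSpace ℝ (Fin n))} (hA : IsCompact A)
    {m : EuclideanSpace ℝ (Fin n)} (hm : m ∈ convexHull ℝ A) : ∃ c ∈ A, dist m c ≤ hdist A := by
  have hne : A.Nonempty := convexHull_nonempty_iff.1 ⟨m, hm⟩
  obtain ⟨c, hc, hmc⟩ := hA.exists_infDist_eq_dist hne m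
  refine ⟨c, hc, hmc ▸ Metric.infDist_le_hausdorffDist_of_mem hm ?_⟩
  exact Metric.hausdorffEDist_ne_top_of_nonempty_of_bounded ⟨m, hm⟩ hne
    (isBounded_convexHull.2 hA.isBounded) hA.isBounded

/-- A parallelogram around `x` whose side along `A` is shortest has that side at most
`2 * hdist A`. -/
lemma dist_le_two_mul_hdist {A B : Set (EuclideanSpace ℝ (Fin 2))} (hA : IsCompact A)
    {x a₁ a₂ b₁ b₂ : EuclideanSpace ℝ (Fin 2)} (ha₁ : a₁ ∈ A) (ha₂ : a₂ ∈ A) (hb₁ : b₁ ∈ B)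
    (hb₂ : b₂ ∈ B) (hx : x ∈ segment ℝ a₁ a₂ + segment ℝ b₁ b₂) (hx₂ : x ∉ convexHull ℝ A + B)
    (hmin : ∀ a₁' ∈ A, ∀ a₂' ∈ A, x ∈ segment ℝ a₁' a₂' + segment ℝ b₁ b₂ →
      dist a₁ a₂ ≤ dist a₁' a₂') :
    dist a₁ a₂ ≤ 2 * hdist A := by
  by_contra! hlt
  obtain ⟨c, hc, hmc⟩ := exists_dist_le_hdist hA (m := midpoint ℝ a₁ a₂)
    (segment_subset_convexHull ha₁ ha₂ (midpoint_mem_segment a₁ a₂))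
  have h₁ : dist a₁ (midpoint ℝ a₁ a₂) = dist a₁ a₂ / 2 := by
    rw [dist_left_midpoint]; norm_num; ring
  have h₂ : dist (midpoint ℝ a₁ a₂) a₂ = dist a₁ a₂ / 2 := by
    rw [dist_midpoint_right]; norm_num; ring
  rcases segment_add_segment_replace (by simp) c hx with h | h | h
  · linarith [hmin _ ha₁ _ hc h, dist_triangle a₁ (midpoint ℝ a₁ a₂) c]
  · linarith [hmin _ hc _ ha₂ h, dist_triangle c (midpoint ℝ a₁ a₂) a₂,
      dist_comm c (midpoint ℝ a₁ a₂)]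
  · refine hx₂ (Set.add_subset_add (convexHull_mono ?_) ?_ h) <;> simp [Set.insert_subset_iff, *]

/-- Among the parallelograms around `x` with vertices in `A + B`, one has minimal side sum. -/
lemma exists_minimal_parallelogram {E : Type*} [NormedAddCommGroup E] [NormedSpace ℝ E]
    {A B : Set E} (hA : IsCompact A) (hB : IsCompact B) {x : E}
    (hx : ∃ a₁ ∈ A, ∃ a₂ ∈ A, ∃ b₁ ∈ B, ∃ b₂ ∈ B, x ∈ segment ℝ a₁ a₂ + segment ℝ b₁ b₂) :
    ∃ a₁ ∈ A, ∃ a₂ ∈ A, ∃ b₁ ∈ B, ∃ b₂ ∈ B, x ∈ segment ℝ a₁ a₂ + segment ℝ b₁ b₂ ∧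
      ∀ a₁' ∈ A, ∀ a₂' ∈ A, ∀ b₁' ∈ B, ∀ b₂' ∈ B,
        x ∈ segment ℝ a₁' a₂' + segment ℝ b₁' b₂' →
          dist a₁ a₂ + dist b₁ b₂ ≤ dist a₁' a₂' + dist b₁' b₂' := by
  let g : (E × E × ℝ) × (E × E × ℝ) → E := fun p =>
    ((1 - p.1.2.2) • p.1.1 + p.1.2.2 • p.1.2.1) + ((1 - p.2.2.2) • p.2.1 + p.2.2.2 • p.2.2.1)
  let K : Set ((E × E × ℝ) × (E × E × ℝ)) :=
    ((A ×ˢ A ×ˢ Set.Icc 0 1) ×ˢ (B ×ˢ B ×ˢ Set.Icc 0 1)) ∩ g ⁻¹' {x}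
  have hmem : ∀ {a₁ a₂ b₁ b₂}, a₁ ∈ A → a₂ ∈ A → b₁ ∈ B → b₂ ∈ B →
      x ∈ segment ℝ a₁ a₂ + segment ℝ b₁ b₂ → ∃ s t, ((a₁, a₂, s), (b₁, b₂, t)) ∈ K := by
    intro a₁ a₂ b₁ b₂ ha₁ ha₂ hb₁ hb₂ h
    simp only [segment_eq_image] at h
    obtain ⟨_, ⟨s, hs, rfl⟩, _, ⟨t, ht, rfl⟩, h⟩ := h
    exact ⟨s, t, ⟨⟨ha₁, ha₂, hs⟩, hb₁, hb₂, ht⟩, h⟩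
  have hK : IsCompact K :=
    ((hA.prod (hA.prod isCompact_Icc)).prod (hB.prod (hB.prod isCompact_Icc))).inter_right
      (isClosed_singleton.preimage (by fun_prop))
  have hKne : K.Nonempty := by
    obtain ⟨a₁, ha₁, a₂, ha₂, b₁, hb₁, b₂, hb₂, h⟩ := hx
    obtain ⟨s, t, h⟩ := hmem ha₁ ha₂ hb₁ hb₂ h
    exact ⟨_, h⟩
  obtain ⟨⟨⟨a₁, a₂, s⟩, b₁, b₂, t⟩, ⟨⟨⟨ha₁, ha₂, hs⟩, hb₁, hb₂, ht⟩, hp⟩, hmin⟩ :=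
    hK.exists_isMinOn hKne (f := fun p => dist p.1.1 p.1.2.1 + dist p.2.1 p.2.2.1) (by fun_prop)
  refine ⟨a₁, ha₁, a₂, ha₂, b₁, hb₁, b₂, hb₂, ?_, fun a₁' ha₁' a₂' ha₂' b₁' hb₁' b₂' hb₂' h => ?_⟩
  · simp only [segment_eq_image]
    exact ⟨_, ⟨s, hs, rfl⟩, _, ⟨t, ht, rfl⟩, hp⟩
  · obtain ⟨s', t', h⟩ := hmem ha₁' ha₂' hb₁' hb₂' h
    exact hmin h

end Helpers

theorem sumset_convexHull_two_dimension (A B : Set (EuclideanSpace ℝ (Fin 2)))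
    (hAc : IsCompact A) (hBc : IsCompact B)
    (h0A : (0 : EuclideanSpace ℝ (Fin 2)) ∈ A) (h0B : (0 : EuclideanSpace ℝ (Fin 2)) ∈ B)
    (hdimA : affineSpan ℝ A = ⊤) (hdimB : affineSpan ℝ B = ⊤)
    (x : EuclideanSpace ℝ (Fin 2))
    (hx : x ∈ convexHull ℝ (A + B))
    (hx₁ : x ∉ A + convexHull ℝ B) (hx₂ : x ∉ convexHull ℝ A + B) :
    ∃ a₁ ∈ A, ∃ a₂ ∈ A, ∃ b₁ ∈ B, ∃ b₂ ∈ B,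
      dist a₁ a₂ ≤ 2 * hdist A ∧ dist b₁ b₂ ≤ 2 * hdist B ∧
      x ∈ segment ℝ a₁ a₂ + segment ℝ b₁ b₂ := by
  obtain ⟨a₁, ha₁, a₂, ha₂, b₁, hb₁, b₂, hb₂, h, hmin⟩ :=
    exists_minimal_parallelogram hAc hBc (exists_mem_segment_add_segment (by simp) hx hx₁ hx₂)
  refine ⟨a₁, ha₁, a₂, ha₂, b₁, hb₁, b₂, hb₂, ?_, ?_, h⟩
  · refine dist_le_two_mul_hdist hAc ha₁ ha₂ hb₁ hb₂ h hx₂ fun a₁' ha₁' a₂' ha₂' h' => ?_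
    linarith [hmin _ ha₁' _ ha₂' _ hb₁ _ hb₂ h']
  · rw [add_comm] at h hx₁
    refine dist_le_two_mul_hdist hBc hb₁ hb₂ ha₁ ha₂ h hx₁ fun b₁' hb₁' b₂' hb₂' h' => ?_
    rw [add_comm] at h'
    linarith [hmin _ ha₁ _ ha₂ _ hb₁' _ hb₂' h']
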